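/- Fix J ≥ 0 and an integer k ≥ 1. For Lebesgue-almost every h ∈ ℝ, the k-th moment of the magnetization factorizes in the thermodynamic limit: lim_{N→∞} ( ω_N(m^k) − (ω_N(m))^k ) = 0. -/

import Mathlib

open Filter MeasureTheory

noncomputable section

/-- The value of a spin encoded by a Boolean: `+1` or `-1`. -/
def spin (b : Bool) : ℝ := if b then 1 else -1

/-- Magnetization of a configuration of `N` spins. -/
def mag (N : ℕ) (σ : Fin N → Bool) : ℝ := (∑ i, spin (σ i)) / N

/-- Curie-Weiss Hamiltonian. -/
def ham (N : ℕ) (J h : ℝ) (σ : Fin N → Bool) : ℝ :=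
  -(N * (J / 2 * mag N σ ^ 2 + h * mag N σ))

/-- Curie-Weiss partition function. -/
def Z (N : ℕ) (J h : ℝ) : ℝ := ∑ σ : Fin N → Bool, Real.exp (-ham N J h σ)

/-- Gibbs expectation of an observable `f`. -/
def gibbs (N : ℕ) (J h : ℝ) (f : (Fin N → Bool) → ℝ) : ℝ :=
  (∑ σ : Fin N → Bool, f σ * Real.exp (-ham N J h σ)) / Z N J h

lemma abs_mag_le (N : ℕ) (σ : Fin N → Bool) : |mag N σ| ≤ 1 := by
  unfold mag
  rw [abs_div, Nat.abs_cast]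
  refine div_le_one_of_le₀ ?_ (Nat.cast_nonneg N)
  refine (Finset.abs_sum_le_sum_abs _ _).trans ?_
  have : ∀ i ∈ (Finset.univ : Finset (Fin N)), |spin (σ i)| ≤ 1 := by
    intro i _
    unfold spin
    split_ifs <;> simp
  simpa using Finset.sum_le_sum this

lemma nat_mul_mag (N : ℕ) (σ : Fin N → Bool) : N * mag N σ = ∑ i, spin (σ i) := by
  unfold mag
  rcases Nat.eq_zero_or_pos N with rfl | h
  · simp
  · field_simp

lemma Z_pos (N : ℕ) (J h : ℝ) : 0 < Z N J h := by
  unfold Z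
  exact Finset.sum_pos (fun _ _ => Real.exp_pos _) Finset.univ_nonempty

lemma ham_shift (N : ℕ) (J h t : ℝ) (σ : Fin N → Bool) :
    -ham N J (h + t) σ = N * t * mag N σ + -ham N J h σ := by
  unfold ham; ring

lemma Z_mul_le (J h : ℝ) (hJ : 0 ≤ J) (a b : ℕ) : Z (a + b) J h ≤ Z a J h * Z b J h := by
  unfold Z
  rw [Finset.sum_mul_sum, ← Finset.sum_product', Finset.univ_product_univ,
    ← (Fin.appendEquiv a b).sum_comp]
  refine Finset.sum_le_sum ?_
  rintro ⟨x, y⟩ _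
  rw [← Real.exp_add, Real.exp_le_exp]
  have key : ((a + b : ℕ) : ℝ) * mag (a + b) (Fin.appendEquiv a b (x, y))
      = a * mag a x + b * mag b y := by
    simp only [nat_mul_mag]
    rw [Fin.sum_univ_add]
    simp [Fin.appendEquiv]
  unfold ham
  generalize mag (a + b) (Fin.appendEquiv a b (x, y)) = m at key
  generalize mag a x = p at key
  generalize mag b y = q at key
  push_cast at key ⊢
  have ha : (0 : ℝ) ≤ a := Nat.cast_nonneg a
  have hb : (0 : ℝ) ≤ b := Nat.cast_nonneg b
  have sq : ((a : ℝ) + b) * m ^ 2 ≤ a * p ^ 2 + b * q ^ 2 := by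
    rcases (add_nonneg ha hb).eq_or_lt with h0 | h0
    · rw [← h0]; simp; positivity
    · refine le_of_mul_le_mul_left ?_ h0
      have : ((a : ℝ) + b) * ((a + b) * m ^ 2) = (a * p + b * q) ^ 2 := by rw [← key]; ring
      rw [this]
      nlinarith [mul_nonneg (mul_nonneg ha hb) (sq_nonneg (p - q))]
  have h1 := mul_le_mul_of_nonneg_left sq (by positivity : 0 ≤ J / 2)
  have h2 : h * (((a : ℝ) + b) * m) = h * (a * p + b * q) := by rw [key]
  linarith

lemma subadd (J h : ℝ) (hJ : 0 ≤ J) : Subadditive (fun N => Real.log (Z N J h)) := by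
  intro a b
  rw [← Real.log_mul (Z_pos _ _ _).ne' (Z_pos _ _ _).ne']
  exact Real.log_le_log (Z_pos _ _ _) (Z_mul_le J h hJ a b)

lemma log_Z_shift (N : ℕ) (J x y : ℝ) :
    Real.log (Z N J x) ≤ Real.log (Z N J y) + N * |x - y| := by
  have : Z N J x ≤ Z N J y * Real.exp (N * |x - y|) := by
    unfold Z
    rw [Finset.sum_mul]
    refine Finset.sum_le_sum fun σ _ => ?_
    rw [← Real.exp_add, Real.exp_le_exp]
    have h1 := ham_shift N J y (x - y) σ
    rw [add_sub_cancel] at h1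
    rw [h1, add_comm, mul_assoc]
    gcongr
    calc (x - y) * mag N σ ≤ |(x - y) * mag N σ| := le_abs_self _
      _ = |x - y| * |mag N σ| := abs_mul _ _
      _ ≤ |x - y| * 1 := by gcongr; exact abs_mag_le N σ
      _ = _ := mul_one _
  have h2 := Real.log_le_log (Z_pos _ _ _) this
  rwa [Real.log_mul (Z_pos _ _ _).ne' (Real.exp_pos _).ne', Real.log_exp] at h2

lemma log_Z_zero_nonneg (N : ℕ) (J : ℝ) (hJ : 0 ≤ J) : 0 ≤ Real.log (Z N J 0) := by
  apply Real.log_nonneg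
  unfold Z
  have h1 : (1 : ℝ) ≤ Real.exp (-ham N J 0 (fun _ => true)) := by
    rw [Real.one_le_exp_iff]
    unfold ham
    rw [neg_neg]
    simp only [zero_mul, add_zero]
    positivity
  exact h1.trans (Finset.single_le_sum (f := fun σ => Real.exp (-ham N J 0 σ))
    (fun _ _ => (Real.exp_pos _).le) (Finset.mem_univ _))

lemma bdd (J h : ℝ) (hJ : 0 ≤ J) :
    BddBelow (Set.range fun N : ℕ => Real.log (Z N J h) / N) := by
  refine ⟨-|h|, ?_⟩
  rintro _ ⟨N, rfl⟩
  rcases Nat.eq_zero_or_pos N with rfl | hN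
  · simp
  · have hN' : (0 : ℝ) < N := by exact_mod_cast hN
    simp only
    rw [le_div_iff₀ hN']
    have h1 := log_Z_shift N J 0 h
    have h2 := log_Z_zero_nonneg N J hJ
    rw [zero_sub, abs_neg] at h1
    linarith

lemma exists_pressure (J : ℝ) (hJ : 0 ≤ J) : ∃ f : ℝ → ℝ, LipschitzWith 1 f ∧
    ∀ h, Tendsto (fun N : ℕ => Real.log (Z N J h) / N) atTop (nhds (f h)) := by
  have ht : ∀ h, Tendsto (fun N : ℕ => Real.log (Z N J h) / N) atTop
      (nhds (subadd J h hJ).lim) := fun h => (subadd J h hJ).tendsto_lim (bdd J h hJ)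
  refine ⟨fun h => (subadd J h hJ).lim, ?_, ht⟩
  refine LipschitzWith.of_le_add fun x y => ?_
  refine le_of_tendsto_of_tendsto (ht x) ((ht y).add_const _) ?_
  filter_upwards [eventually_gt_atTop 0] with N hN
  have hN' : (0 : ℝ) < N := by exact_mod_cast hN
  have h1 := log_Z_shift N J x y
  rw [Real.dist_eq, div_add' _ _ _ hN'.ne']
  gcongr
  linarith

lemma gibbs_mono (N : ℕ) (J h : ℝ) {f g : (Fin N → Bool) → ℝ} (hfg : ∀ σ, f σ ≤ g σ) :
    gibbs N J h f ≤ gibbs N J h g := by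
  unfold gibbs
  have := Z_pos N J h
  gcongr with σ
  exact hfg σ

lemma gibbs_add (N : ℕ) (J h : ℝ) (f g : (Fin N → Bool) → ℝ) :
    gibbs N J h (fun σ => f σ + g σ) = gibbs N J h f + gibbs N J h g := by
  unfold gibbs
  simp only [add_mul, Finset.sum_add_distrib, add_div]

lemma gibbs_mul (N : ℕ) (J h c : ℝ) (f : (Fin N → Bool) → ℝ) :
    gibbs N J h (fun σ => c * f σ) = c * gibbs N J h f := by
  unfold gibbs
  simp only [mul_assoc, ← Finset.mul_sum, mul_div_assoc]

lemma gibbs_const (N : ℕ) (J h c : ℝ) : gibbs N J h (fun _ => c) = c := by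
  unfold gibbs
  rw [← Finset.mul_sum]
  exact mul_div_cancel_right₀ c (Z_pos N J h).ne'

lemma gibbs_exp (N : ℕ) (J h t : ℝ) :
    gibbs N J h (fun σ => Real.exp (N * t * mag N σ)) = Z N J (h + t) / Z N J h := by
  unfold gibbs
  simp only [← Real.exp_add, ← ham_shift]
  rfl

/-- Chernoff functional tends to zero. -/
lemma chernoff (J : ℝ) (f : ℝ → ℝ)
    (hf : ∀ h, Tendsto (fun N : ℕ => Real.log (Z N J h) / N) atTop (nhds (f h)))
    (h t b : ℝ) (hlt : f (h + t) - f h - t * b < 0) :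
    Tendsto (fun N : ℕ => gibbs N J h (fun σ => Real.exp (N * t * (mag N σ - b))))
      atTop (nhds 0) := by
  have e : ∀ᶠ N : ℕ in atTop, Real.exp (N * (Real.log (Z N J (h + t)) / N
      - Real.log (Z N J h) / N - t * b)) =
      gibbs N J h (fun σ => Real.exp (N * t * (mag N σ - b))) := by
    filter_upwards [eventually_gt_atTop 0] with N hN
    have hN' : (N : ℝ) ≠ 0 := by exact_mod_cast hN.ne'
    have h1 : (fun σ => Real.exp (N * t * (mag N σ - b)))
        = fun σ => Real.exp (-(N * t * b)) * Real.exp (N * t * mag N σ) := by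
      funext σ
      rw [← Real.exp_add]; congr 1; ring
    rw [h1, gibbs_mul, gibbs_exp]
    have h2 : N * (Real.log (Z N J (h + t)) / N - Real.log (Z N J h) / N - t * b)
        = -(N * t * b) + (Real.log (Z N J (h + t)) - Real.log (Z N J h)) := by
      field_simp; ring
    rw [h2, Real.exp_add, Real.exp_sub, Real.exp_log (Z_pos _ _ _), Real.exp_log (Z_pos _ _ _)]
  refine Tendsto.congr' e ?_
  refine Real.tendsto_exp_atBot.comp ?_
  exact Tendsto.atTop_mul_neg hlt tendsto_natCast_atTop_atTop
    (((hf (h + t)).sub (hf h)).sub_const _)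

lemma moment_tendsto (J : ℝ) (f : ℝ → ℝ)
    (hf : ∀ h, Tendsto (fun N : ℕ => Real.log (Z N J h) / N) atTop (nhds (f h)))
    (h c : ℝ) (hd : HasDerivAt f c h) (k : ℕ) :
    Tendsto (fun N : ℕ => gibbs N J h (fun σ => mag N σ ^ k)) atTop (nhds (c ^ k)) := by
  rw [Metric.tendsto_atTop']
  intro δ hδ
  obtain ⟨ε, hε, hcont⟩ := Metric.continuousAt_iff.1
    ((continuous_pow k).continuousAt (x := c) : ContinuousAt (fun x : ℝ => x ^ k) c)
    (δ / 2) (by positivity)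
  have hs := hasDerivAt_iff_isLittleO_nhds_zero.1 hd
  have hs' := hs.def (c := ε / 2) (by positivity)
  obtain ⟨r, hr, hball⟩ := Metric.eventually_nhds_iff.1 hs'
  set t := r / 2 with htdef
  have ht : 0 < t := by positivity
  have hp := hball (y := t) (by rw [Real.dist_eq, sub_zero, abs_of_pos ht]; linarith)
  have hm := hball (y := -t) (by rw [Real.dist_eq, sub_zero, abs_neg, abs_of_pos ht]; linarith)
  simp only [Real.norm_eq_abs, smul_eq_mul, abs_neg, abs_of_pos ht] at hp hm
  have htε : 0 < t * ε := by positivity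
  have c1 := chernoff J f hf h t (c + ε) (by have := (abs_le.1 hp).2; nlinarith)
  have c2 := chernoff J f hf h (-t) (c - ε) (by have := (abs_le.1 hm).2; nlinarith)
  set C := 1 + |c| ^ k with hC
  have hCpos : 0 < C := by positivity
  have c3 := (c1.add c2).const_mul C
  simp only [add_zero, mul_zero] at c3
  have c4 := c3.eventually (gt_mem_nhds (show 0 < δ / 2 by positivity))
  obtain ⟨M, hM⟩ := eventually_atTop.1 c4
  refine ⟨M, fun N hN => ?_⟩
  have hb := hM N hN.le
  -- pointwise bound
  have pt : ∀ σ, |mag N σ ^ k - c ^ k| ≤ δ / 2 + C * (Real.exp (N * t * (mag N σ - (c + ε)))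
      + Real.exp (N * (-t) * (mag N σ - (c - ε)))) := by
    intro σ
    have hNt : 0 ≤ N * t := by positivity
    by_cases hclose : |mag N σ - c| < ε
    · have := hcont (x := mag N σ) (by rwa [Real.dist_eq])
      rw [Real.dist_eq] at this
      have : 0 ≤ C * (Real.exp (N * t * (mag N σ - (c + ε)))
        + Real.exp (N * (-t) * (mag N σ - (c - ε)))) := by positivity
      linarith
    · have hbig : |mag N σ ^ k - c ^ k| ≤ C := by
        refine (abs_sub _ _).trans ?_
        rw [abs_pow, abs_pow]
        have := pow_le_one₀ (n := k) (abs_nonneg _) (abs_mag_le N σ)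
        linarith
      have hone : 1 ≤ Real.exp (N * t * (mag N σ - (c + ε)))
          + Real.exp (N * (-t) * (mag N σ - (c - ε))) := by
        rcases le_abs.1 (not_lt.1 hclose) with h1 | h1
        · have : 1 ≤ Real.exp (N * t * (mag N σ - (c + ε))) :=
            Real.one_le_exp (mul_nonneg hNt (by linarith))
          linarith [Real.exp_pos (N * (-t) * (mag N σ - (c - ε)))]
        · have : 1 ≤ Real.exp (N * (-t) * (mag N σ - (c - ε))) := by
            apply Real.one_le_exp
            have := mul_nonneg hNt (show 0 ≤ -(mag N σ - (c - ε)) by linarith)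
            linarith
          linarith [Real.exp_pos (N * t * (mag N σ - (c + ε)))]
      have := mul_le_mul_of_nonneg_left hone hCpos.le
      linarith
  have up := gibbs_mono N J h (f := fun σ => mag N σ ^ k) (fun σ => by
    have := (abs_le.1 (pt σ)).2
    exact sub_le_iff_le_add.1 this)
  have lo := gibbs_mono N J h (f := fun _ => c ^ k) (g := fun σ => mag N σ ^ k +
      (δ / 2 + C * (Real.exp (N * t * (mag N σ - (c + ε)))
      + Real.exp (N * (-t) * (mag N σ - (c - ε)))))) (fun σ => by
    have := (abs_le.1 (pt σ)).1
    linarith)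
  simp only [gibbs_add, gibbs_mul, gibbs_const] at up lo
  rw [Real.dist_eq, abs_lt]
  constructor <;> linarith

/-- For fixed `J ≥ 0`, `k ≥ 1` and Lebesgue-almost every `h`, the `k`-th moment of the
magnetization factorizes in the thermodynamic limit. -/
theorem curieWeiss_moment_factorization (J : ℝ) (hJ : 0 ≤ J) (k : ℕ) (hk : 1 ≤ k) :
    ∀ᵐ h ∂(volume : Measure ℝ),
      Tendsto (fun N : ℕ =>
          gibbs N J h (fun σ => mag N σ ^ k) - gibbs N J h (mag N) ^ k)
        atTop (nhds 0) := by
  obtain ⟨f, hL, hf⟩ := exists_pressure J hJ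
  filter_upwards [hL.ae_differentiableAt_real] with h hh
  have h1 := moment_tendsto J f hf h _ hh.hasDerivAt k
  have h2 := moment_tendsto J f hf h _ hh.hasDerivAt 1
  simp only [pow_one] at h2
  simpa using h1.sub (h2.pow k)
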